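/- arXiv:1906.00942 — 3 statements merged into one kernel-verified Lean document; each statement's English description precedes it below -/
import Mathlib

section
/- Let G be a finite group with subgroups N and S such that N is normal in G, N ∩ S = {1}, G = NS, and the orders |N| and |S| are coprime. Let G'' be a normal subgroup of G. Then G'' = (G'' ∩ N)(G'' ∩ S); moreover G'' ∩ N is a normal subgroup of N and G'' ∩ S is a normal subgroup of S, so G'' is the internal semidirect product of G'' ∩ N with G'' ∩ S. -/
/-- Let `G` be a finite group with a normal subgroup `N` and a subgroup `S` such that
`N ∩ S = 1`, `G = NS` and `|N|` is coprime to `|S|`.  If `G''` is a normal subgroup of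
`G`, then `G'' = (G'' ∩ N)(G'' ∩ S)`; moreover `G'' ∩ N` is normal in `N` and
`G'' ∩ S` is normal in `S`, so `G''` is the internal semidirect product of its normal
subgroup `G'' ∩ N` with the subgroup `G'' ∩ S`. -/
theorem normal_subgroup_internal_semidirect {G : Type*} [Group G] [Finite G]
    (N S : Subgroup G) (hN : N.Normal) (hNS : N ⊓ S = ⊥)
    (hprod : ∀ g : G, ∃ x ∈ N, ∃ y ∈ S, g = x * y)
    (hcop : Nat.Coprime (Nat.card N) (Nat.card S))
    (G'' : Subgroup G) (hG'' : G''.Normal) :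
    (∀ g ∈ G'', ∃ x ∈ G'' ⊓ N, ∃ y ∈ G'' ⊓ S, g = x * y) ∧
    ((G'' ⊓ N).subgroupOf N).Normal ∧
    ((G'' ⊓ S).subgroupOf S).Normal ∧
    ((G'' ⊓ N).subgroupOf G'').Normal ∧
    (G'' ⊓ N) ⊓ (G'' ⊓ S) = ⊥ := by
  have := hN
  have := hG''
  refine ⟨?_, ?_, ?_, ?_, ?_⟩
  · intro g hg
    obtain ⟨x, hx, y, hy, rfl⟩ := hprod g
    have h1 : QuotientGroup.mk' G'' x * QuotientGroup.mk' G'' y = 1 := by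
      rw [← map_mul]
      exact (QuotientGroup.eq_one_iff _).2 hg
    have hxy : orderOf (QuotientGroup.mk' G'' x) = orderOf (QuotientGroup.mk' G'' y) := by
      rw [eq_inv_of_mul_eq_one_left h1, orderOf_inv]
    have hdx : orderOf (QuotientGroup.mk' G'' x) ∣ Nat.card N :=
      (orderOf_map_dvd _ x).trans (Subgroup.orderOf_dvd_natCard N hx)
    have hdy : orderOf (QuotientGroup.mk' G'' x) ∣ Nat.card S :=
      hxy ▸ (orderOf_map_dvd _ y).trans (Subgroup.orderOf_dvd_natCard S hy)
    have hone : QuotientGroup.mk' G'' x = 1 :=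
      orderOf_eq_one_iff.1 (Nat.eq_one_of_dvd_coprimes hcop hdx hdy)
    have hxG : x ∈ G'' := (QuotientGroup.eq_one_iff _).1 hone
    exact ⟨x, ⟨hxG, hx⟩, y, ⟨(Subgroup.mul_mem_cancel_left _ hxG).1 hg, hy⟩, rfl⟩
  · rw [Subgroup.inf_subgroupOf_right]
    infer_instance
  · rw [Subgroup.inf_subgroupOf_right]
    infer_instance
  · rw [Subgroup.inf_subgroupOf_left]
    infer_instance
  · exact le_bot_iff.1 (hNS ▸ inf_le_inf inf_le_right inf_le_right)
end

section
/- Let 𝒢 be a stable class of finite groups, and let 𝒢̃ be the class of all finite groups isomorphic to an iterated semidirect product ((G₁ ⋊ G₂) ⋊ ⋯) ⋊ G_r, r ≥ 1, with each G_i in 𝒢 and the orders |G_i|, |G_j| coprime for all i ≠ j. Then 𝒢̃ is also a stable class of finite groups. -/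
universe u

/-- A class `C` of finite groups is stable if it is closed under isomorphism, and for
every `G ∈ C`, every quotient and every normal subgroup of `G` belongs to `C`. -/
def IsStableClass (C : ∀ (G : Type u) [Group G], Prop) : Prop :=
  (∀ (G : Type u) [Group G], C G → Finite G) ∧
  (∀ (G G' : Type u) [Group G] [Group G'], C G → Nonempty (G ≃* G') → C G') ∧
  (∀ (G : Type u) [Group G], C G → ∀ (H : Subgroup G) [H.Normal], C (G ⧸ H)) ∧
  (∀ (G : Type u) [Group G], C G → ∀ H : Subgroup G, H.Normal → C H)

/-- Membership in the class `𝒢̃` of iterated semidirect products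
`((G₁ ⋊ G₂) ⋊ ⋯) ⋊ G_r`, `r ≥ 1`, with all `G_i ∈ C` and `|G_i|, |G_j|` coprime for
`i ≠ j`, described internally: either `G ∈ C` (the case `r = 1`), or `G` is the
internal semidirect product of a normal subgroup `K` (an iterated semidirect product
with factors in `C`) and a subgroup `S ∈ C` with `|K|` coprime to `|S|`.  (Since
`|K| = |G₁|⋯|G_{r-1}|`, the coprimality of `|K|` and `|S|` at every stage is
equivalent to pairwise coprimality of the `|G_i|`.) -/
inductive IterSdpClass (C : ∀ (G : Type u) [Group G], Prop) :
    ∀ (G : Type u) [Group G], Prop where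
  | base : ∀ (G : Type u) [Group G], C G → IterSdpClass C G
  | step : ∀ (G : Type u) [Group G] (K S : Subgroup G), K.Normal → K ⊓ S = ⊥ →
      (∀ g : G, ∃ x ∈ K, ∃ y ∈ S, g = x * y) →
      Nat.Coprime (Nat.card K) (Nat.card S) →
      IterSdpClass C K → C S → IterSdpClass C G

theorem iterSdp_finite (C : ∀ (G : Type u) [Group G], Prop) (hC : IsStableClass C)
    (G : Type u) [Group G] (h : IterSdpClass C G) : Finite G := by
  induction h with
  | base G h => exact hC.1 G h
  | step G K S hK hi hm hco hKc hS ih =>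
    have := hC.1 _ hS
    have hs : Function.Surjective (fun p : K × S => (p.1 : G) * p.2) := by
      intro g
      obtain ⟨x, hx, y, hy, rfl⟩ := hm g
      exact ⟨(⟨x, hx⟩, ⟨y, hy⟩), rfl⟩
    exact Finite.of_surjective _ hs

theorem stable_of_surj (C : ∀ (G : Type u) [Group G], Prop) (hC : IsStableClass C)
    (G : Type u) [Group G] (h : C G) (G' : Type u) [Group G'] (f : G →* G')
    (hf : Function.Surjective f) : C G' :=
  hC.2.1 _ _ (hC.2.2.1 G h f.ker) ⟨QuotientGroup.quotientKerEquivOfSurjective f hf⟩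

theorem iterSdp_of_surj (C : ∀ (G : Type u) [Group G], Prop) (hC : IsStableClass C)
    (G : Type u) [Group G] (h : IterSdpClass C G) : ∀ (G' : Type u) [Group G'] (f : G →* G'),
    Function.Surjective f → IterSdpClass C G' := by
  induction h with
  | base G h => exact fun G' _ f hf => .base _ (stable_of_surj C hC G h G' f hf)
  | step G K S hK hi hm hco hKc hS ih =>
    intro G' _ f hf
    have hco' : Nat.Coprime (Nat.card (K.map f)) (Nat.card (S.map f)) :=
      Nat.Coprime.of_dvd (Subgroup.card_map_dvd K f) (Subgroup.card_map_dvd S f) hco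
    refine .step G' (K.map f) (S.map f) (hK.map f hf)
      (Subgroup.disjoint_of_coprime_natCard hco').eq_bot ?_ hco'
      (ih _ (f.subgroupMap K) (f.subgroupMap_surjective K))
      (stable_of_surj C hC _ hS _ (f.subgroupMap S) (f.subgroupMap_surjective S))
    intro g'
    obtain ⟨g, rfl⟩ := hf g'
    obtain ⟨x, hx, y, hy, rfl⟩ := hm g
    exact ⟨f x, Subgroup.mem_map_of_mem f hx, f y, Subgroup.mem_map_of_mem f hy, map_mul f x y⟩

theorem iterSdp_of_inj (C : ∀ (G : Type u) [Group G], Prop) (hC : IsStableClass C)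
    (G : Type u) [Group G] (h : IterSdpClass C G) : ∀ (H : Type u) [Group H] (f : H →* G),
    Function.Injective f → f.range.Normal → IterSdpClass C H := by
  induction h with
  | base G h =>
    intro H _ f hf hn
    exact .base _ (hC.2.1 _ _ (hC.2.2.2 G h f.range hn) ⟨(f.ofInjective hf).symm⟩)
  | step G K S hK hi hm hco hKc hS ih =>
    intro H _ f hf hn
    have hcompl : Subgroup.IsComplement' K S := by
      apply Subgroup.isComplement'_of_disjoint_and_mul_eq_univ (disjoint_iff.2 hi)
      refine Set.eq_univ_of_forall fun g => ?_
      obtain ⟨x, hx, y, hy, rfl⟩ := hm g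
      exact Set.mul_mem_mul hx hy
    let e : G ⧸ K ≃* S := hcompl.symm.QuotientMulEquiv
    let p : G →* S := e.toMonoidHom.comp (QuotientGroup.mk' K)
    have hp : Function.Surjective p := e.surjective.comp (QuotientGroup.mk'_surjective K)
    have hpk : p.ker = K := by
      ext g
      simp [p]
    let q : H →* S := p.comp f
    have hqk : q.ker = K.comap f := by
      rw [← hpk]; rfl
    have hqn : q.range.Normal := by
      have : q.range = f.range.map p := MonoidHom.range_comp p f
      rw [this]; exact hn.map p hp
    have hKn : (K.comap f).Normal := hK.comap f
    have hinj : Function.Injective (f.subgroupComap K) := by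
      intro a b hab
      exact Subtype.ext (hf (congrArg Subtype.val hab))
    have hd1 : Nat.card (K.comap f) ∣ Nat.card K := Subgroup.card_dvd_of_injective _ hinj
    have hd2 : (K.comap f).index ∣ Nat.card S := by
      rw [← hqk, Subgroup.index_ker]
      exact Subgroup.card_subgroup_dvd_card _
    obtain ⟨T, hT⟩ := Subgroup.exists_right_complement'_of_coprime
      (Nat.Coprime.of_dvd hd1 hd2 hco)
    have hTe : q.range ≃* T :=
      ((QuotientGroup.quotientKerEquivRange q).symm.trans
        (QuotientGroup.quotientMulEquivOfEq hqk)).trans hT.symm.QuotientMulEquiv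
    have hcT : C T := hC.2.1 _ _ (hC.2.2.2 S hS q.range hqn) ⟨hTe⟩
    have hrn : (f.subgroupComap K).range.Normal := by
      have : (f.subgroupComap K).range = f.range.subgroupOf K := by
        ext ⟨x, hx⟩
        constructor
        · rintro ⟨y, hy⟩
          exact ⟨y, congrArg Subtype.val hy⟩
        · rintro ⟨y, hy⟩
          have hy' : f y = x := hy
          refine ⟨⟨y, ?_⟩, Subtype.ext hy'⟩
          change f y ∈ K
          rw [hy']; exact hx
      rw [this]; infer_instance
    refine .step H (K.comap f) T hKn hT.disjoint.eq_bot ?_ ?_ (ih _ _ hinj hrn) hcT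
    · intro g
      obtain ⟨⟨x, y⟩, hxy⟩ := hT.2 g
      exact ⟨x, x.2, y, y.2, hxy.symm⟩
    · refine Nat.Coprime.of_dvd hd1 ?_ hco
      rw [← Nat.card_congr hTe.toEquiv]
      exact Subgroup.card_subgroup_dvd_card _

/-- If `𝒢` is a stable class of finite groups, then so is the class `𝒢̃` of iterated
semidirect products of groups in `𝒢` with pairwise coprime orders. -/
theorem isStableClass_iterSdpClass (C : ∀ (G : Type u) [Group G], Prop)
    (hC : IsStableClass C) : IsStableClass (IterSdpClass C) := by
  refine ⟨fun G _ h => iterSdp_finite C hC G h, ?_, ?_, ?_⟩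
  · rintro G G' _ _ h ⟨e⟩
    exact iterSdp_of_surj C hC G h G' e.toMonoidHom e.surjective
  · intro G _ h H _
    exact iterSdp_of_surj C hC G h _ (QuotientGroup.mk' H) (QuotientGroup.mk'_surjective H)
  · intro G _ h H hH
    refine iterSdp_of_inj C hC G h _ H.subtype H.subtype_injective ?_
    rw [Subgroup.range_subtype]; exact hH
end

section
/- Let m₁, …, m_r be nonzero integers such that m_i and m_j are coprime whenever i ≠ j, let D be a finite group isomorphic to an iterated semidirect product ((ℤ/m₁ ⋊ ℤ/m₂) ⋊ ⋯) ⋊ ℤ/m_r, and let p be a prime dividing m_r. Then the Sylow p-subgroups of D are cyclic, and there is a surjective group homomorphism from D onto a Sylow p-subgroup of D. -/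
/-- A group `D` is an (internal) iterated semidirect product
`((D₁ ⋊ D₂) ⋊ ⋯) ⋊ D_r` with `D_i ≅ ℤ/m_i`, witnessed by a chain
`1 = K₀ ⊴ K₁ ⊴ ⋯ ⊴ K_r = D` and subgroups `S_i ≅ ℤ/m_{i+1}` with
`K_{i+1} = K_i ⋊ S_i` internally. -/
def IsIteratedCyclicSdp {r : ℕ} (m : Fin r → ℤ) (D : Type*) [Group D] : Prop :=
  ∃ (K : Fin (r + 1) → Subgroup D) (S : Fin r → Subgroup D),
    K 0 = ⊥ ∧ K (Fin.last r) = ⊤ ∧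
    ∀ i : Fin r,
      K i.castSucc ≤ K i.succ ∧
      ((K i.castSucc).subgroupOf (K i.succ)).Normal ∧
      S i ≤ K i.succ ∧
      K i.castSucc ⊓ S i = ⊥ ∧
      K i.castSucc ⊔ S i = K i.succ ∧
      Nonempty (S i ≃* Multiplicative (ZMod (m i).natAbs))

lemma aux_card_dvd {G : Type*} [Group G] (A B : Subgroup G) [A.Normal] (h : A ⊔ B = ⊤) :
    Nat.card G ∣ Nat.card A * Nat.card B := by
  have h1 : A.index = A.relIndex B := by
    rw [← Subgroup.relIndex_top_right, ← h, Subgroup.relIndex_sup_left]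
  rw [← A.card_mul_index, h1]
  exact mul_dvd_mul_left _ (Subgroup.relIndex_dvd_card A B)

lemma aux_card_dvd_chain {G : Type*} [Group G] (A B C : Subgroup G) (hA : A ≤ C) (hB : B ≤ C)
    (hn : (A.subgroupOf C).Normal) (h : A ⊔ B = C) :
    Nat.card C ∣ Nat.card A * Nat.card B := by
  have h1 : A.subgroupOf C ⊔ B.subgroupOf C = ⊤ := by
    rw [← Subgroup.subgroupOf_sup hA hB, h, Subgroup.subgroupOf_self]
  have h2 := aux_card_dvd _ _ h1
  rwa [Nat.card_congr (Subgroup.subgroupOfEquivOfLe hA).toEquiv,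
    Nat.card_congr (Subgroup.subgroupOfEquivOfLe hB).toEquiv] at h2

lemma aux_main {D : Type*} [Group D] [Finite D] (N : Subgroup D) [N.Normal]
    (hc : IsCyclic (D ⧸ N)) (p : ℕ) (hp : p.Prime) (hN : ¬ p ∣ Nat.card N) :
    (∀ P : Sylow p D, IsCyclic (P : Subgroup D)) ∧
    ∃ P : Sylow p D, ∃ f : D →* (P : Subgroup D), Function.Surjective f := by
  haveI : Fact p.Prime := ⟨hp⟩
  have hcyc : ∀ P : Sylow p D, IsCyclic (P : Subgroup D) := by
    intro P
    refine isCyclic_of_injective ((QuotientGroup.mk' N).comp (P : Subgroup D).subtype) ?_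
    rw [injective_iff_map_eq_one]
    rintro ⟨x, hx⟩ h
    have hxN : x ∈ N := by simpa using h
    have hcop : (Nat.card N).Coprime (Nat.card (P : Subgroup D)) := by
      rw [P.card_eq_multiplicity]
      exact ((hp.coprime_iff_not_dvd.2 hN).pow_left _).symm
    have := (Subgroup.disjoint_of_coprime_natCard hcop).le_bot ⟨hxN, hx⟩
    simpa using this
  refine ⟨hcyc, ?_⟩
  obtain ⟨P⟩ : Nonempty (Sylow p D) := inferInstance
  refine ⟨P, ?_⟩
  letI : CommGroup (D ⧸ N) := IsCyclic.commGroup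
  set q := Nat.card (D ⧸ N) with hq
  have hq0 : q ≠ 0 := Nat.card_pos.ne'
  have hDq : (Nat.card D).factorization p = q.factorization p := by
    rw [Subgroup.card_eq_card_quotient_mul_card_subgroup N,
      Nat.factorization_mul Nat.card_pos.ne' Nat.card_pos.ne', Finsupp.add_apply,
      Nat.factorization_eq_zero_of_not_dvd hN, add_zero]
  let g : (D ⧸ N) →* (D ⧸ N) := powMonoidHom (ordCompl[p] q)
  have hcard : Nat.card g.range = Nat.card (P : Subgroup D) := by
    rw [P.card_eq_multiplicity, hDq, IsCyclic.card_powMonoidHom_range, ← hq,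
      Nat.gcd_eq_right (Nat.ordCompl_dvd q p)]
    exact Nat.div_div_self (Nat.ordProj_dvd q p) hq0
  haveI := hcyc P
  let e : g.range ≃* (P : Subgroup D) := mulEquivOfCyclicCardEq hcard
  exact ⟨(e.toMonoidHom.comp g.rangeRestrict).comp (QuotientGroup.mk' N),
    (e.surjective.comp g.rangeRestrict_surjective).comp (QuotientGroup.mk'_surjective N)⟩

/-- Let `m₁, …, m_r` be nonzero pairwise coprime integers, let `D` be a finite group
isomorphic to an iterated semidirect product `((ℤ/m₁ ⋊ ℤ/m₂) ⋊ ⋯) ⋊ ℤ/m_r`, and let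
`p` be a prime dividing `m_r`.  Then the Sylow `p`-subgroups of `D` are cyclic and `D`
surjects onto a Sylow `p`-subgroup of `D`. -/
theorem sylow_cyclic_and_surjection_of_iterated_cyclic
    {n : ℕ} (m : Fin (n + 1) → ℤ) (hm0 : ∀ i, m i ≠ 0)
    (hcop : ∀ i j, i ≠ j → IsCoprime (m i) (m j))
    {D : Type*} [Group D] [Finite D]
    (hD : IsIteratedCyclicSdp m D)
    (p : ℕ) (hp : p.Prime) (hpdvd : (p : ℤ) ∣ m (Fin.last n)) :
    (∀ P : Sylow p D, IsCyclic (P : Subgroup D)) ∧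
    ∃ P : Sylow p D, ∃ f : D →* (P : Subgroup D), Function.Surjective f := by
  obtain ⟨K, S, hK0, hKtop, hstep⟩ := hD
  have hcardS : ∀ i, Nat.card (S i) = (m i).natAbs := by
    intro i
    obtain ⟨e⟩ := (hstep i).2.2.2.2.2
    rw [Nat.card_congr e.toEquiv, Nat.card_congr Multiplicative.toAdd, Nat.card_zmod]
  have hSp : ∀ i, i ≠ Fin.last n → ¬ p ∣ Nat.card (S i) := by
    intro i hi hd
    rw [hcardS, ← Int.natCast_dvd] at hd
    have := (hcop i _ hi).isUnit_of_dvd' hd hpdvd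
    rw [Int.isUnit_iff_natAbs_eq, Int.natAbs_natCast] at this
    exact hp.one_lt.ne' this
  have hKp : ∀ i : Fin (n + 1), ¬ p ∣ Nat.card (K i.castSucc) := by
    intro i
    induction i using Fin.induction with
    | zero =>
      rw [Fin.castSucc_zero, hK0, Subgroup.card_bot]
      exact hp.one_lt.ne' ∘ Nat.dvd_one.1
    | succ i ih =>
      obtain ⟨h1, h2, h3, -, h5, -⟩ := hstep i.castSucc
      intro hd
      rw [← Fin.succ_castSucc] at hd
      rcases hp.dvd_mul.1 (hd.trans (aux_card_dvd_chain _ _ _ h1 h3 h2 h5)) with h | h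
      · exact ih h
      · exact hSp _ (Fin.castSucc_lt_last i).ne h
  obtain ⟨h1, h2, h3, -, h5, ⟨e⟩⟩ := hstep (Fin.last n)
  rw [Fin.succ_last, hKtop] at h1 h2 h3 h5
  haveI hN : (K (Fin.last n).castSucc).Normal := by
    rwa [Subgroup.normal_subgroupOf_iff_le_normalizer h1, top_le_iff,
      Subgroup.normalizer_eq_top_iff] at h2
  haveI : IsCyclic (S (Fin.last n)) := e.isCyclic.2 inferInstance
  refine aux_main (K (Fin.last n).castSucc) ?_ p hp (hKp _)
  refine isCyclic_of_surjective
    ((QuotientGroup.mk' (K (Fin.last n).castSucc)).comp (S (Fin.last n)).subtype) ?_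
  intro x
  obtain ⟨d, rfl⟩ := QuotientGroup.mk'_surjective _ x
  have hd : d ∈ K (Fin.last n).castSucc ⊔ S (Fin.last n) := h5 ▸ Subgroup.mem_top d
  obtain ⟨a, ha, b, hb, rfl⟩ := Subgroup.mem_sup_of_normal_left.1 hd
  refine ⟨⟨b, hb⟩, ?_⟩
  have : (QuotientGroup.mk' (K (Fin.last n).castSucc)) a = 1 := by simpa using ha
  simp only [map_mul, this, one_mul, MonoidHom.comp_apply, Subgroup.subtype_apply]
end
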